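/- arXiv:1410.8438 — 3 statements merged into one kernel-verified Lean document; each statement's English description precedes it below -/
import Mathlib

section
/- Let V be an archimedean Riesz space and let G be a subgroup of the additive group of V closed under binary suprema and infima, such that V is the smallest vector sublattice of V containing G. If moreover G is divisible (for every g ∈ G and every integer n ≥ 1 there is x ∈ G with n • x = g), then G is order dense in V: for every v ∈ V with v > 0 there exists g ∈ G with 0 < g ≤ v. -/
section OrderedModule

variable {V : Type*} [AddCommGroup V] [Module ℝ V]

lemma ratCast_smul_mem_of_divisible {G : AddSubgroup V}
    (hdiv : ∀ g ∈ G, ∀ n : ℤ, 1 ≤ n → ∃ x ∈ G, n • x = g) {g : V} (hg : g ∈ G) (q : ℚ) :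
    (q : ℝ) • g ∈ G := by
  obtain ⟨x, hx, rfl⟩ := hdiv g hg q.den (by exact_mod_cast q.pos)
  have h : (q : ℝ) • ((q.den : ℤ) • x) = q.num • x := by
    rw [← Int.cast_smul_eq_zsmul ℝ, ← Int.cast_smul_eq_zsmul ℝ, smul_smul]
    congr 1
    exact_mod_cast q.mul_den_eq_num
  rw [h]
  exact G.zsmul_mem hx _

variable [Lattice V]

/-- The elements of `V` all of whose real multiples are uniform limits, relative to a fixed
regulator in `G`, of elements of `G`. -/
def UniformlyApproximable (G : AddSubgroup V) (v : V) : Prop :=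
  ∃ u ∈ G, 0 ≤ u ∧ ∀ r ε : ℝ, 0 < ε → ∃ w ∈ G, r • v ≤ w + ε • u ∧ w ≤ r • v + ε • u

lemma UniformlyApproximable.add [IsOrderedAddMonoid V] {G : AddSubgroup V} {a b : V}
    (ha : UniformlyApproximable G a) (hb : UniformlyApproximable G b) :
    UniformlyApproximable G (a + b) := by
  obtain ⟨u, hu, hu0, h⟩ := ha
  obtain ⟨u', hu', hu0', h'⟩ := hb
  refine ⟨u + u', G.add_mem hu hu', add_nonneg hu0 hu0', fun r ε hε => ?_⟩
  obtain ⟨w, hw, h1, h2⟩ := h r ε hε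
  obtain ⟨w', hw', h1', h2'⟩ := h' r ε hε
  refine ⟨w + w', G.add_mem hw hw', ?_, ?_⟩
  · rw [smul_add, smul_add, add_add_add_comm]
    exact add_le_add h1 h1'
  · rw [smul_add, smul_add, add_add_add_comm]
    exact add_le_add h2 h2'

lemma UniformlyApproximable.smul {G : AddSubgroup V} {a : V} (s : ℝ)
    (ha : UniformlyApproximable G a) : UniformlyApproximable G (s • a) := by
  obtain ⟨u, hu, hu0, h⟩ := ha
  refine ⟨u, hu, hu0, fun r ε hε => ?_⟩
  rw [smul_smul]
  exact h (r * s) ε hε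

variable [PosSMulMono ℝ V]

lemma real_smul_sup_of_nonneg {r : ℝ} (hr : 0 ≤ r) (a b : V) :
    r • (a ⊔ b) = r • a ⊔ r • b := by
  rcases hr.eq_or_lt with rfl | hr
  · simp
  · exact (OrderIso.smulRight hr).map_sup a b

variable [IsOrderedAddMonoid V]

lemma real_smul_sup_of_nonpos {r : ℝ} (hr : r ≤ 0) (a b : V) :
    r • (a ⊔ b) = r • a ⊓ r • b := by
  rw [← neg_inj, neg_inf, ← neg_smul, ← neg_smul, ← neg_smul,
    real_smul_sup_of_nonneg (neg_nonneg.2 hr)]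

lemma UniformlyApproximable.sup {G : AddSubgroup V}
    (hsup : ∀ a ∈ G, ∀ b ∈ G, a ⊔ b ∈ G) (hinf : ∀ a ∈ G, ∀ b ∈ G, a ⊓ b ∈ G) {a b : V}
    (ha : UniformlyApproximable G a) (hb : UniformlyApproximable G b) :
    UniformlyApproximable G (a ⊔ b) := by
  obtain ⟨u, hu, hu0, h⟩ := ha
  obtain ⟨u', hu', hu0', h'⟩ := hb
  refine ⟨u + u', G.add_mem hu hu', add_nonneg hu0 hu0', fun r ε hε => ?_⟩
  obtain ⟨w, hw, h1, h2⟩ := h r ε hε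
  obtain ⟨w', hw', h1', h2'⟩ := h' r ε hε
  have hle : ε • u ≤ ε • (u + u') := smul_le_smul_of_nonneg_left (le_add_of_nonneg_right hu0') hε.le
  have hle' : ε • u' ≤ ε • (u + u') := smul_le_smul_of_nonneg_left (le_add_of_nonneg_left hu0) hε.le
  replace h1 := h1.trans (add_le_add_right hle _)
  replace h2 := h2.trans (add_le_add_right hle _)
  replace h1' := h1'.trans (add_le_add_right hle' _)
  replace h2' := h2'.trans (add_le_add_right hle' _)
  rcases le_total 0 r with hr | hr
  · refine ⟨w ⊔ w', hsup _ hw _ hw', ?_, ?_⟩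
    · rw [real_smul_sup_of_nonneg hr, sup_add]
      exact sup_le_sup h1 h1'
    · rw [real_smul_sup_of_nonneg hr, sup_add]
      exact sup_le_sup h2 h2'
  · refine ⟨w ⊓ w', hinf _ hw _ hw', ?_, ?_⟩
    · rw [real_smul_sup_of_nonpos hr, inf_add]
      exact inf_le_inf h1 h1'
    · rw [real_smul_sup_of_nonpos hr, inf_add]
      exact inf_le_inf h2 h2'

lemma UniformlyApproximable.inf {G : AddSubgroup V}
    (hsup : ∀ a ∈ G, ∀ b ∈ G, a ⊔ b ∈ G) (hinf : ∀ a ∈ G, ∀ b ∈ G, a ⊓ b ∈ G) {a b : V}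
    (ha : UniformlyApproximable G a) (hb : UniformlyApproximable G b) :
    UniformlyApproximable G (a ⊓ b) := by
  have h := ((ha.smul (-1)).sup hsup hinf (hb.smul (-1))).smul (-1)
  rwa [real_smul_sup_of_nonpos (by norm_num : (-1 : ℝ) ≤ 0), smul_smul, smul_smul, neg_mul_neg,
    one_mul, one_smul, one_smul] at h

lemma real_smul_le_smul_abs {s ε : ℝ} (hs : |s| ≤ ε) (g : V) : s • g ≤ ε • |g| := by
  have h1 : s • g ≤ |s| • |g| := by
    rcases le_total 0 s with h | h
    · rw [abs_of_nonneg h]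
      exact smul_le_smul_of_nonneg_left (le_abs_self g) h
    · rw [abs_of_nonpos h, ← neg_smul_neg]
      exact smul_le_smul_of_nonneg_left (neg_le_abs g) (neg_nonneg.2 h)
  have h2 : 0 ≤ (ε - |s|) • |g| := smul_nonneg (sub_nonneg.2 hs) (abs_nonneg g)
  rw [sub_smul, sub_nonneg] at h2
  exact h1.trans h2

lemma UniformlyApproximable.of_mem {G : AddSubgroup V}
    (hsup : ∀ a ∈ G, ∀ b ∈ G, a ⊔ b ∈ G)
    (hdiv : ∀ g ∈ G, ∀ n : ℤ, 1 ≤ n → ∃ x ∈ G, n • x = g) {g : V} (hg : g ∈ G) :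
    UniformlyApproximable G g := by
  refine ⟨|g|, hsup _ hg _ (G.neg_mem hg), abs_nonneg g, fun r ε hε => ?_⟩
  obtain ⟨q, hq1, hq2⟩ := exists_rat_btwn (lt_add_of_pos_right r hε)
  refine ⟨(q : ℝ) • g, ratCast_smul_mem_of_divisible hdiv hg q, ?_, ?_⟩
  · rw [← sub_le_iff_le_add', ← sub_smul]
    exact real_smul_le_smul_abs (abs_le.2 ⟨by linarith, by linarith⟩) g
  · rw [← sub_le_iff_le_add', ← sub_smul]
    exact real_smul_le_smul_abs (abs_le.2 ⟨by linarith, by linarith⟩) g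

lemma UniformlyApproximable.exists_pos_le {G : AddSubgroup V}
    (harch : ∀ x y : V, (∀ n : ℕ, n • x ≤ y) → x ≤ 0)
    (hsup : ∀ a ∈ G, ∀ b ∈ G, a ⊔ b ∈ G)
    (hdiv : ∀ g ∈ G, ∀ n : ℤ, 1 ≤ n → ∃ x ∈ G, n • x = g) {v : V}
    (h : UniformlyApproximable G v) (hv : 0 < v) : ∃ g ∈ G, 0 < g ∧ g ≤ v := by
  obtain ⟨u, hu, hu0, h⟩ := h
  by_contra! hcon
  refine hv.not_ge (harch v (u + u) fun n => ?_)
  rcases n.eq_zero_or_pos with rfl | hn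
  · simpa using add_nonneg hu0 hu0
  have hn' : (0 : ℝ) < n := by exact_mod_cast hn
  obtain ⟨w, hw, h1, h2⟩ := h 1 (n : ℝ)⁻¹ (inv_pos.2 hn')
  rw [one_smul] at h1 h2
  have hεu : (n : ℝ)⁻¹ • u ∈ G := by
    simpa using ratCast_smul_mem_of_divisible hdiv hu (n : ℚ)⁻¹
  have hnot : ¬ 0 < (w - (n : ℝ)⁻¹ • u) ⊔ 0 := fun hpos =>
    hcon _ (hsup _ (G.sub_mem hw hεu) _ G.zero_mem) hpos
      (sup_le (sub_le_iff_le_add.2 h2) hv.le)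
  have hw0 : w - (n : ℝ)⁻¹ • u ≤ 0 := by
    by_contra hne
    exact hnot (lt_of_le_of_ne le_sup_right fun heq => hne (heq ▸ le_sup_left))
  have h3 : v ≤ (n : ℝ)⁻¹ • (u + u) := by
    rw [smul_add]
    exact h1.trans (add_le_add_left (sub_nonpos.1 hw0) _)
  have h4 := smul_le_smul_of_nonneg_left h3 hn'.le
  rwa [smul_inv_smul₀ hn'.ne', Nat.cast_smul_eq_nsmul] at h4

end OrderedModule


/-- If `V` is an archimedean Riesz space and `G` is a divisible sublattice-subgroup of `V`
such that `V` is the smallest vector sublattice of `V` containing `G`, then `G` is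
order dense in `V`. -/
theorem divisible_sublattice_subgroup_generating_is_order_dense
    (V : Type) [Lattice V] [AddCommGroup V] [Module ℝ V]
    (hVcov : ∀ a b c : V, a ≤ b → a + c ≤ b + c)
    (hVpos : ∀ (r : ℝ) (x : V), 0 ≤ r → 0 ≤ x → 0 ≤ r • x)
    (hVarch : ∀ x y : V, (∀ n : ℕ, n • x ≤ y) → x ≤ 0)
    (G : AddSubgroup V)
    (hGsup : ∀ a ∈ G, ∀ b ∈ G, a ⊔ b ∈ G)
    (hGinf : ∀ a ∈ G, ∀ b ∈ G, a ⊓ b ∈ G)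
    (hGgen : ∀ S : Submodule ℝ V, (∀ a ∈ S, ∀ b ∈ S, a ⊔ b ∈ S) →
      (∀ a ∈ S, ∀ b ∈ S, a ⊓ b ∈ S) → (∀ g ∈ G, g ∈ S) → ∀ x : V, x ∈ S)
    (hGdiv : ∀ g ∈ G, ∀ n : ℤ, 1 ≤ n → ∃ x ∈ G, n • x = g) :
    ∀ v : V, 0 < v → ∃ g ∈ G, 0 < g ∧ g ≤ v := by
  have : IsOrderedAddMonoid V := { add_le_add_left := fun a b h c => hVcov a b c h }
  have : PosSMulMono ℝ V := PosSMulMono.of_smul_nonneg fun r hr x hx => hVpos r x hr hx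
  let S : Submodule ℝ V :=
    { carrier := {v | UniformlyApproximable G v}
      add_mem' := fun ha hb => ha.add hb
      zero_mem' := UniformlyApproximable.of_mem hGsup hGdiv G.zero_mem
      smul_mem' := fun r _ hv => hv.smul r }
  intro v hv
  have hvS : v ∈ S := hGgen S (fun _ ha _ hb => UniformlyApproximable.sup hGsup hGinf ha hb)
    (fun _ ha _ hb => UniformlyApproximable.inf hGsup hGinf ha hb)
    (fun _ hg => UniformlyApproximable.of_mem hGsup hGdiv hg) v
  exact UniformlyApproximable.exists_pos_le hVarch hGsup hGdiv hvS hv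
end

section
/- Let V be a Riesz space, let G be a subgroup of the additive group of V closed under binary suprema and infima, and let G_d = { x ∈ V : n • x ∈ G for some integer n ≥ 1 }. Then G_d is a divisible sublattice-subgroup of V containing G, and the smallest vector sublattice of V containing G equals the smallest vector sublattice of V containing G_d. (The Riesz hull of a semisimple MV-algebra coincides with the Riesz hull of its divisible hull.) -/
/-- The smallest vector sublattice of a Riesz space `V` containing a set `S`:
the intersection of all linear subspaces of `V` that are closed under binary
suprema and infima and contain `S`. -/
def vectorSublatticeClosure (V : Type) [Lattice V] [AddCommGroup V] [Module ℝ V]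
    (S : Set V) : Set V :=
  ⋂₀ {T : Set V | ∃ M : Submodule ℝ V, (M : Set V) = T ∧
      (∀ a ∈ M, ∀ b ∈ M, a ⊔ b ∈ M) ∧ (∀ a ∈ M, ∀ b ∈ M, a ⊓ b ∈ M) ∧ S ⊆ T}

theorem zsmul_sup_of_pos {V : Type*} [Lattice V] [AddCommGroup V] [Module ℝ V] [PosSMulMono ℝ V]
    {n : ℤ} (hn : 1 ≤ n) (a b : V) : n • (a ⊔ b) = n • a ⊔ n • b := by
  have hr : (0 : ℝ) < n := by exact_mod_cast hn
  simp only [← Int.cast_smul_eq_zsmul ℝ n]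
  exact (OrderIso.smulRight hr).map_sup a b

theorem zsmul_inf_of_pos {V : Type*} [Lattice V] [AddCommGroup V] [Module ℝ V] [PosSMulMono ℝ V]
    {n : ℤ} (hn : 1 ≤ n) (a b : V) : n • (a ⊓ b) = n • a ⊓ n • b := by
  have hr : (0 : ℝ) < n := by exact_mod_cast hn
  simp only [← Int.cast_smul_eq_zsmul ℝ n]
  exact (OrderIso.smulRight hr).map_inf a b

theorem mem_of_zsmul_mem {V : Type*} [AddCommGroup V] [Module ℝ V] (M : Submodule ℝ V)
    {n : ℤ} (hn : 1 ≤ n) {x : V} (hx : n • x ∈ M) : x ∈ M := by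
  have hr : (n : ℝ) ≠ 0 := by exact_mod_cast (by lia : n ≠ 0)
  rw [← Int.cast_smul_eq_zsmul ℝ n] at hx
  exact (M.smul_mem_iff hr).1 hx

/-- Two elements with positive multiples in `G` have a common positive multiplier. -/
theorem AddSubgroup.exists_common_zsmul_mem {V : Type*} [AddCommGroup V] (G : AddSubgroup V)
    {a b : V} (ha : ∃ n : ℤ, 1 ≤ n ∧ n • a ∈ G) (hb : ∃ n : ℤ, 1 ≤ n ∧ n • b ∈ G) :
    ∃ n : ℤ, 1 ≤ n ∧ n • a ∈ G ∧ n • b ∈ G := by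
  obtain ⟨n, hn, ha⟩ := ha
  obtain ⟨m, hm, hb⟩ := hb
  refine ⟨n * m, one_le_mul_of_one_le_of_one_le hn hm, ?_, ?_⟩
  · rw [mul_comm, mul_smul]
    exact G.zsmul_mem ha m
  · rw [mul_smul]
    exact G.zsmul_mem hb n

/-- For a sublattice-subgroup `G` of a Riesz space `V`, the set
`G_d = { x ∈ V : n • x ∈ G for some integer n ≥ 1 }` is a divisible
sublattice-subgroup of `V` containing `G`, and the smallest vector sublattice of `V`
containing `G` equals the smallest vector sublattice of `V` containing `G_d`. -/
theorem divisible_hull_has_same_riesz_hull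
    (V : Type) [Lattice V] [AddCommGroup V] [Module ℝ V]
    (hVcov : ∀ a b c : V, a ≤ b → a + c ≤ b + c)
    (hVpos : ∀ (r : ℝ) (x : V), 0 ≤ r → 0 ≤ x → 0 ≤ r • x)
    (G : AddSubgroup V)
    (hGsup : ∀ a ∈ G, ∀ b ∈ G, a ⊔ b ∈ G)
    (hGinf : ∀ a ∈ G, ∀ b ∈ G, a ⊓ b ∈ G) :
    let Gd : Set V := {x : V | ∃ n : ℤ, 1 ≤ n ∧ n • x ∈ G}
    (∃ A : AddSubgroup V, (A : Set V) = Gd) ∧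
    (∀ a ∈ Gd, ∀ b ∈ Gd, a ⊔ b ∈ Gd) ∧
    (∀ a ∈ Gd, ∀ b ∈ Gd, a ⊓ b ∈ Gd) ∧
    (∀ g ∈ Gd, ∀ n : ℤ, 1 ≤ n → ∃ x ∈ Gd, n • x = g) ∧
    (G : Set V) ⊆ Gd ∧
    vectorSublatticeClosure V (G : Set V) = vectorSublatticeClosure V Gd := by
  intro Gd
  have : IsOrderedAddMonoid V :=
    { add_le_add_left := fun a b h c => hVcov a b c h }
  have : PosSMulMono ℝ V := PosSMulMono.of_smul_nonneg fun r hr x hx => hVpos r x hr hx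
  have hGGd : (G : Set V) ⊆ Gd := fun x hx => ⟨1, le_rfl, by simpa using hx⟩
  refine ⟨⟨{ carrier := Gd, zero_mem' := hGGd G.zero_mem, add_mem' := ?_, neg_mem' := ?_ }, rfl⟩,
    ?_, ?_, ?_, hGGd, ?_⟩
  · intro a b ha hb
    obtain ⟨n, hn, ha, hb⟩ := G.exists_common_zsmul_mem ha hb
    exact ⟨n, hn, by rw [smul_add]; exact G.add_mem ha hb⟩
  · rintro a ⟨n, hn, ha⟩
    exact ⟨n, hn, by rw [smul_neg]; exact G.neg_mem ha⟩
  · intro a ha b hb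
    obtain ⟨n, hn, ha, hb⟩ := G.exists_common_zsmul_mem ha hb
    exact ⟨n, hn, by rw [zsmul_sup_of_pos hn]; exact hGsup _ ha _ hb⟩
  · intro a ha b hb
    obtain ⟨n, hn, ha, hb⟩ := G.exists_common_zsmul_mem ha hb
    exact ⟨n, hn, by rw [zsmul_inf_of_pos hn]; exact hGinf _ ha _ hb⟩
  · rintro g ⟨m, hm, hg⟩ n hn
    have hr : (n : ℝ) ≠ 0 := by exact_mod_cast (by lia : n ≠ 0)
    have hng : n • ((n : ℝ)⁻¹ • g) = g := by
      rw [← Int.cast_smul_eq_zsmul ℝ n, smul_inv_smul₀ hr]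
    exact ⟨(n : ℝ)⁻¹ • g, ⟨m * n, one_le_mul_of_one_le_of_one_le hm hn, by
      rwa [mul_smul, hng]⟩, hng⟩
  · apply Set.Subset.antisymm
    · rintro x hx T ⟨M, hM, hsup, hinf, hT⟩
      exact hx T ⟨M, hM, hsup, hinf, hGGd.trans hT⟩
    · rintro x hx T ⟨M, rfl, hsup, hinf, hT⟩
      exact hx M ⟨M, rfl, hsup, hinf, fun y ⟨n, hn, hy⟩ => mem_of_zsmul_mem M hn (hT hy)⟩
end

section
/- Let G and H be archimedean lattice-ordered abelian groups, and for each let (U_G, ι_G) and (U_H, ι_H) be Riesz hulls: U_G, U_H are archimedean Riesz spaces, ι_G : G → U_G and ι_H : H → U_H are injective essential lattice-group homomorphisms, U_G is the smallest vector sublattice containing ι_G(G), U_H is the smallest vector sublattice containing ι_H(H), and G, H have strong units mapped by ι_G, ι_H to strong units. Then for every lattice-group homomorphism h : G → H preserving the strong units there exists a unique lattice-group homomorphism R(h) : U_G → U_H with R(h) ∘ ι_G = ι_H ∘ h; moreover R(h) is ℝ-linear, and if h is injective then R(h) is injective. (Functoriality of the Riesz hull.) -/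
/-- The elements of which some positive multiple lies in a given subgroup. -/
def AddSubgroup.divisibleHull {A : Type*} [AddCommGroup A] (D : AddSubgroup A) :
    AddSubgroup A where
  carrier := {c | ∃ n : ℕ, 0 < n ∧ n • c ∈ D}
  zero_mem' := ⟨1, one_pos, by simp⟩
  add_mem' := by
    rintro a b ⟨n, hn, ha⟩ ⟨m, hm, hb⟩
    refine ⟨n * m, Nat.mul_pos hn hm, ?_⟩
    rw [smul_add, mul_comm n m, mul_smul, mul_comm m n, mul_smul]
    exact D.add_mem (D.nsmul_mem ha m) (D.nsmul_mem hb n)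
  neg_mem' := by
    rintro a ⟨n, hn, ha⟩
    exact ⟨n, hn, by simpa using ha⟩

theorem AddSubgroup.le_divisibleHull {A : Type*} [AddCommGroup A] (D : AddSubgroup A) :
    D ≤ D.divisibleHull :=
  fun d hd => ⟨1, one_pos, by simpa using hd⟩

theorem AddSubgroup.ratCast_smul_mem_divisibleHull {A : Type*} [AddCommGroup A] [Module ℝ A]
    {D : AddSubgroup A} {c : A} (hc : c ∈ D.divisibleHull) (q : ℚ) :
    (q : ℝ) • c ∈ D.divisibleHull := by
  obtain ⟨n, hn, hc⟩ := hc
  refine ⟨q.den * n, Nat.mul_pos q.den_pos hn, ?_⟩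
  have h : (q.den * n) • (q : ℝ) • c = q.num • n • c := by
    have hq : (q.den : ℝ) * (q : ℝ) = q.num := by exact_mod_cast q.den_mul_eq_num
    rw [← Nat.cast_smul_eq_nsmul ℝ, ← Nat.cast_smul_eq_nsmul ℝ n c, ← Int.cast_smul_eq_zsmul ℝ,
      smul_smul, smul_smul, ← hq]
    congr 1
    push_cast
    ring
  rw [h]
  exact D.zsmul_mem hc _

theorem nsmul_sup_of_module {E : Type*} [Lattice E] [AddCommGroup E] [Module ℝ E]
    [IsOrderedModule ℝ E] (n : ℕ) (x y : E) : n • (x ⊔ y) = n • x ⊔ n • y := by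
  rcases Nat.eq_zero_or_pos n with rfl | hn
  · simp
  · have hn' : (0 : ℝ) < n := by exact_mod_cast hn
    simp only [← Nat.cast_smul_eq_nsmul ℝ]
    exact (OrderIso.smulRight (β := E) hn').map_sup x y

theorem AddSubgroup.sup_mem_divisibleHull {E : Type*} [Lattice E] [AddCommGroup E] [Module ℝ E]
    [IsOrderedModule ℝ E] {D : AddSubgroup E}
    (hD : ∀ a ∈ D, ∀ b ∈ D, a ⊔ b ∈ D) {a b : E} (ha : a ∈ D.divisibleHull)
    (hb : b ∈ D.divisibleHull) : a ⊔ b ∈ D.divisibleHull := by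
  obtain ⟨n, hn, ha⟩ := ha
  obtain ⟨m, hm, hb⟩ := hb
  refine ⟨n * m, Nat.mul_pos hn hm, ?_⟩
  rw [nsmul_sup_of_module, mul_comm n m, mul_smul, mul_comm m n, mul_smul]
  exact hD _ (D.nsmul_mem ha m) _ (D.nsmul_mem hb n)

theorem abs_smul_le_of_module {E : Type*} [Lattice E] [AddCommGroup E] [Module ℝ E]
    [IsOrderedModule ℝ E] (r : ℝ) (x : E) : |r • x| ≤ |r| • |x| := by
  have key : ∀ (s : ℝ) (y : E), 0 ≤ s → |s • y| ≤ s • |y| := fun s y hs =>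
    abs_le'.2 ⟨smul_le_smul_of_nonneg_left (le_abs_self y) hs, by
      rw [← smul_neg]
      exact smul_le_smul_of_nonneg_left (neg_le_abs y) hs⟩
  rcases le_total 0 r with hr | hr
  · simpa [abs_of_nonneg hr] using key r x hr
  · simpa [abs_of_nonpos hr] using key (-r) x (neg_nonneg.2 hr)

theorem abs_sup_sub_sup_le_add {E : Type*} [Lattice E] [AddCommGroup E]
    [IsOrderedAddMonoid E] (a b c d : E) : |a ⊔ b - c ⊔ d| ≤ |a - c| + |b - d| := by
  calc
    |a ⊔ b - c ⊔ d| = |(a ⊔ b - c ⊔ b) + (c ⊔ b - c ⊔ d)| := by rw [sub_add_sub_cancel]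
    _ ≤ |a ⊔ b - c ⊔ b| + |c ⊔ b - c ⊔ d| := abs_add_le _ _
    _ ≤ |a - c| + |b - d| := by
      gcongr ?_ + ?_
      · exact abs_sup_sub_sup_le_abs _ _ _
      · rw [sup_comm c, sup_comm c]
        exact abs_sup_sub_sup_le_abs _ _ _

/-- Comparison of a rational multiple of `ι g` with one of `ι u` takes place in the group. -/
theorem abs_le_inv_smul_iff {E : Type*} [Lattice E] [AddCommGroup E] [Module ℝ E]
    [IsOrderedModule ℝ E] {G : Type*} [Lattice G] [AddCommGroup G] (ι : G →+ E)
    (hι : ∀ a b : G, ι a ≤ ι b ↔ a ≤ b) {n k : ℕ} (hn : 0 < n) (hk : 0 < k) {a : E} {g u : G}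
    (ha : n • a = ι g) :
    |a| ≤ (k : ℝ)⁻¹ • ι u ↔ k • g ≤ n • u ∧ k • -g ≤ n • u := by
  have hk' : (0 : ℝ) < k := by exact_mod_cast hk
  have hn' : (0 : ℝ) < n := by exact_mod_cast hn
  have key : ∀ (b : E) (f : G), n • b = ι f → (b ≤ (k : ℝ)⁻¹ • ι u ↔ k • f ≤ n • u) := by
    intro b f hb
    rw [le_inv_smul_iff_of_pos hk', ← hι, map_nsmul, map_nsmul, ← hb,
      ← smul_le_smul_iff_of_pos_left hn', Nat.cast_smul_eq_nsmul, Nat.cast_smul_eq_nsmul,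
      Nat.cast_smul_eq_nsmul, smul_comm n k]
  rw [abs_le', key a g ha, key (-a) (-g) (by rw [smul_neg, ha, map_neg])]

section UniformClosure

variable {E : Type*} [Lattice E] [AddCommGroup E] [IsOrderedAddMonoid E] [Module ℝ E]
  [IsOrderedModule ℝ E]

/-- The closure, uniformly with respect to a strong unit `e`, of the divisible hull of a
subgroup. -/
def AddSubgroup.uniformClosure (D : AddSubgroup E) (e : E) (he : 0 ≤ e)
    (hunit : ∀ x : E, ∃ n : ℕ, x ≤ n • e) : Submodule ℝ E where
  carrier := {v | ∀ ε : ℝ, 0 < ε → ∃ c ∈ D.divisibleHull, |v - c| ≤ ε • e}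
  zero_mem' := fun ε hε => ⟨0, zero_mem _, by simpa using smul_nonneg hε.le he⟩
  add_mem' := by
    intro v w hv hw ε hε
    obtain ⟨c, hc, hvc⟩ := hv (ε / 2) (half_pos hε)
    obtain ⟨d, hd, hwd⟩ := hw (ε / 2) (half_pos hε)
    refine ⟨c + d, add_mem hc hd, ?_⟩
    calc |v + w - (c + d)| = |(v - c) + (w - d)| := by rw [add_sub_add_comm]
      _ ≤ |v - c| + |w - d| := abs_add_le _ _
      _ ≤ (ε / 2) • e + (ε / 2) • e := add_le_add hvc hwd
      _ = ε • e := by rw [← add_smul, add_halves]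
  smul_mem' := by
    intro r v hv ε hε
    obtain ⟨c, hc, hvc⟩ := hv (ε / 2 / (|r| + 1)) (by positivity)
    obtain ⟨N, hN⟩ := hunit |c|
    obtain ⟨q, hq⟩ := exists_rat_near r (show 0 < ε / 2 / (N + 1) by positivity)
    refine ⟨(q : ℝ) • c, AddSubgroup.ratCast_smul_mem_divisibleHull hc q, ?_⟩
    have h₁ : |r| * (ε / 2 / (|r| + 1)) ≤ ε / 2 := by
      rw [mul_div_assoc', div_le_iff₀ (by positivity)]
      nlinarith [abs_nonneg r]
    have h₂ : |r - q| * N ≤ ε / 2 := by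
      calc |r - q| * N ≤ ε / 2 / (N + 1) * (N + 1) := by gcongr; linarith
        _ = ε / 2 := by field_simp
    calc |r • v - (q : ℝ) • c| = |r • (v - c) + (r - q) • c| := by
          congr 1; rw [smul_sub, sub_smul]; abel
      _ ≤ |r • (v - c)| + |(r - q) • c| := abs_add_le _ _
      _ ≤ |r| • |v - c| + |r - q| • |c| :=
          add_le_add (abs_smul_le_of_module _ _) (abs_smul_le_of_module _ _)
      _ ≤ |r| • (ε / 2 / (|r| + 1)) • e + |r - q| • N • e :=
          add_le_add (smul_le_smul_of_nonneg_left hvc (abs_nonneg r))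
            (smul_le_smul_of_nonneg_left hN (abs_nonneg _))
      _ = (|r| * (ε / 2 / (|r| + 1)) + |r - q| * N) • e := by
          rw [← Nat.cast_smul_eq_nsmul ℝ, smul_smul, smul_smul, add_smul]
      _ ≤ ε • e := smul_le_smul_of_nonneg_right (by linarith) he

variable {D : AddSubgroup E} {e : E} {he : 0 ≤ e} {hunit : ∀ x : E, ∃ n : ℕ, x ≤ n • e}

theorem AddSubgroup.subset_uniformClosure {d : E} (hd : d ∈ D) :
    d ∈ D.uniformClosure e he hunit :=
  fun _ hε => ⟨d, D.le_divisibleHull hd, by simpa using smul_nonneg hε.le he⟩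

theorem AddSubgroup.sup_mem_uniformClosure (hD : ∀ a ∈ D, ∀ b ∈ D, a ⊔ b ∈ D) {v w : E}
    (hv : v ∈ D.uniformClosure e he hunit) (hw : w ∈ D.uniformClosure e he hunit) :
    v ⊔ w ∈ D.uniformClosure e he hunit := by
  intro ε hε
  obtain ⟨c, hc, hvc⟩ := hv (ε / 2) (half_pos hε)
  obtain ⟨d, hd, hwd⟩ := hw (ε / 2) (half_pos hε)
  refine ⟨c ⊔ d, AddSubgroup.sup_mem_divisibleHull hD hc hd, ?_⟩
  calc |v ⊔ w - c ⊔ d| ≤ |v - c| + |w - d| := abs_sup_sub_sup_le_add _ _ _ _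
    _ ≤ (ε / 2) • e + (ε / 2) • e := add_le_add hvc hwd
    _ = ε • e := by rw [← add_smul, add_halves]

theorem eq_of_abs_sub_le_inv_smul (harch : ∀ x y : E, (∀ n : ℕ, n • x ≤ y) → x ≤ 0)
    (e : E) {x y : E}
    (h : ∀ k : ℕ, 0 < k → ∃ z, |x - z| ≤ (k : ℝ)⁻¹ • e ∧ |y - z| ≤ (k : ℝ)⁻¹ • e) :
    x = y := by
  have habs : |x - y| ≤ 0 := by
    refine harch _ (e + e) fun n => ?_
    obtain ⟨z, hx, hy⟩ := h (n + 1) n.succ_pos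
    have hk : (0 : ℝ) < (n + 1 : ℕ) := by positivity
    have hle : |x - y| ≤ ((n + 1 : ℕ) : ℝ)⁻¹ • (e + e) := by
      calc |x - y| = |(x - z) + (z - y)| := by rw [sub_add_sub_cancel]
        _ ≤ |x - z| + |z - y| := abs_add_le _ _
        _ ≤ _ := by
          rw [abs_sub_comm z y, smul_add]
          exact add_le_add hx hy
    rw [le_inv_smul_iff_of_pos hk, Nat.cast_smul_eq_nsmul] at hle
    exact (nsmul_le_nsmul_left (abs_nonneg _) n.le_succ).trans hle
  exact le_antisymm (sub_nonpos.1 ((le_abs_self _).trans habs))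
    (sub_nonpos.1 (by simpa using (neg_le_abs (x - y)).trans habs))

end UniformClosure

theorem map_le_map_iff_of_map_sup {A B : Type*} [Lattice A] [Lattice B] {f : A → B}
    (hf : Function.Injective f) (hsup : ∀ a b, f (a ⊔ b) = f a ⊔ f b) (a b : A) :
    f a ≤ f b ↔ a ≤ b := by
  rw [← sup_eq_right, ← hsup, hf.eq_iff, sup_eq_right]

theorem monotone_of_map_sup {A B : Type*} [Lattice A] [Lattice B] {f : A → B}
    (hsup : ∀ a b, f (a ⊔ b) = f a ⊔ f b) : Monotone f := fun a b hab => by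
  rw [← sup_eq_right, ← hsup, sup_eq_right.2 hab]


/-- Functoriality of the Riesz hull: a unital lattice-group homomorphism `h : G → H`
between archimedean lattice-ordered abelian groups with strong units lifts uniquely
to a lattice-group homomorphism `R(h)` between their Riesz hulls with
`R(h) ∘ ι_G = ι_H ∘ h`; moreover `R(h)` is `ℝ`-linear and is injective whenever `h` is. -/
theorem riesz_hull_functorial
    (G : Type) [Lattice G] [AddCommGroup G]
    (hGcov : ∀ a b c : G, a ≤ b → a + c ≤ b + c)
    (hGarch : ∀ x y : G, (∀ n : ℕ, n • x ≤ y) → x ≤ 0)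
    (uG : G) (huG0 : 0 ≤ uG) (huG : ∀ x : G, ∃ n : ℕ, x ≤ n • uG)
    (H : Type) [Lattice H] [AddCommGroup H]
    (hHcov : ∀ a b c : H, a ≤ b → a + c ≤ b + c)
    (hHarch : ∀ x y : H, (∀ n : ℕ, n • x ≤ y) → x ≤ 0)
    (uH : H) (huH0 : 0 ≤ uH) (huH : ∀ x : H, ∃ n : ℕ, x ≤ n • uH)
    -- the Riesz hull of G
    (UG : Type) [Lattice UG] [AddCommGroup UG] [Module ℝ UG]
    (hUGcov : ∀ a b c : UG, a ≤ b → a + c ≤ b + c)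
    (hUGpos : ∀ (r : ℝ) (x : UG), 0 ≤ r → 0 ≤ x → 0 ≤ r • x)
    (hUGarch : ∀ x y : UG, (∀ n : ℕ, n • x ≤ y) → x ≤ 0)
    (ιG : G → UG) (hιG_inj : Function.Injective ιG)
    (hιG_add : ∀ a b : G, ιG (a + b) = ιG a + ιG b)
    (hιG_sup : ∀ a b : G, ιG (a ⊔ b) = ιG a ⊔ ιG b)
    (hιG_ess : ∀ b : UG, 0 < b → ∃ a : G, 0 < a ∧ ∃ n : ℕ, ιG a ≤ n • b)
    (hιG_gen : ∀ S : Submodule ℝ UG, (∀ a ∈ S, ∀ b ∈ S, a ⊔ b ∈ S) →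
      (∀ a ∈ S, ∀ b ∈ S, a ⊓ b ∈ S) → (∀ g : G, ιG g ∈ S) → ∀ x : UG, x ∈ S)
    (hιG_unit : 0 ≤ ιG uG ∧ ∀ x : UG, ∃ n : ℕ, x ≤ n • ιG uG)
    -- the Riesz hull of H
    (UH : Type) [Lattice UH] [AddCommGroup UH] [Module ℝ UH]
    (hUHcov : ∀ a b c : UH, a ≤ b → a + c ≤ b + c)
    (hUHpos : ∀ (r : ℝ) (x : UH), 0 ≤ r → 0 ≤ x → 0 ≤ r • x)
    (hUHarch : ∀ x y : UH, (∀ n : ℕ, n • x ≤ y) → x ≤ 0)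
    (ιH : H → UH) (hιH_inj : Function.Injective ιH)
    (hιH_add : ∀ a b : H, ιH (a + b) = ιH a + ιH b)
    (hιH_sup : ∀ a b : H, ιH (a ⊔ b) = ιH a ⊔ ιH b)
    (hιH_ess : ∀ b : UH, 0 < b → ∃ a : H, 0 < a ∧ ∃ n : ℕ, ιH a ≤ n • b)
    (hιH_gen : ∀ S : Submodule ℝ UH, (∀ a ∈ S, ∀ b ∈ S, a ⊔ b ∈ S) →
      (∀ a ∈ S, ∀ b ∈ S, a ⊓ b ∈ S) → (∀ g : H, ιH g ∈ S) → ∀ x : UH, x ∈ S)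
    (hιH_unit : 0 ≤ ιH uH ∧ ∀ x : UH, ∃ n : ℕ, x ≤ n • ιH uH)
    -- a unital lattice-group homomorphism h : G → H
    (h : G → H)
    (hh_add : ∀ a b : G, h (a + b) = h a + h b)
    (hh_sup : ∀ a b : G, h (a ⊔ b) = h a ⊔ h b)
    (hh_unit : h uG = uH) :
    ∃ Rh : UG → UH,
      (∀ a b : UG, Rh (a + b) = Rh a + Rh b) ∧
      (∀ a b : UG, Rh (a ⊔ b) = Rh a ⊔ Rh b) ∧
      (∀ g : G, Rh (ιG g) = ιH (h g)) ∧
      (∀ (r : ℝ) (x : UG), Rh (r • x) = r • Rh x) ∧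
      (Function.Injective h → Function.Injective Rh) ∧
      (∀ Rh' : UG → UH, (∀ a b : UG, Rh' (a + b) = Rh' a + Rh' b) →
        (∀ a b : UG, Rh' (a ⊔ b) = Rh' a ⊔ Rh' b) →
        (∀ g : G, Rh' (ιG g) = ιH (h g)) → Rh' = Rh) := by
  have : IsOrderedAddMonoid UG := ⟨fun a b hab c => by
    simpa only [add_comm] using hUGcov a b c hab, fun a b hab c => by
    simpa only [add_comm] using hUGcov a b c hab⟩
  have : IsOrderedAddMonoid UH := ⟨fun a b hab c => by
    simpa only [add_comm] using hUHcov a b c hab, fun a b hab c => by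
    simpa only [add_comm] using hUHcov a b c hab⟩
  have : IsOrderedModule ℝ UG := .of_smul_nonneg fun r hr x hx => hUGpos r x hr hx
  have : IsOrderedModule ℝ UH := .of_smul_nonneg fun r hr x hx => hUHpos r x hr hx
  have : IsOrderedModule ℝ (UG × UH) := {}
  let jG : G →+ UG := AddMonoidHom.mk' ιG hιG_add
  let jH : H →+ UH := AddMonoidHom.mk' ιH hιH_add
  let φ : G →+ H := AddMonoidHom.mk' h hh_add
  have hjG : ∀ a b : G, jG a ≤ jG b ↔ a ≤ b := map_le_map_iff_of_map_sup hιG_inj hιG_sup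
  have hjH : ∀ a b : H, jH a ≤ jH b ↔ a ≤ b := map_le_map_iff_of_map_sup hιH_inj hιH_sup
  have hφ : Monotone φ := monotone_of_map_sup hh_sup
  have hφu : φ uG = uH := hh_unit
  let D : AddSubgroup (UG × UH) := (jG.prod (jH.comp φ)).range
  have hD : ∀ a ∈ D, ∀ b ∈ D, a ⊔ b ∈ D := by
    rintro _ ⟨a, rfl⟩ _ ⟨b, rfl⟩
    refine ⟨a ⊔ b, Prod.ext (hιG_sup a b) ?_⟩
    change ιH (h (a ⊔ b)) = ιH (h a) ⊔ ιH (h b)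
    rw [hh_sup, hιH_sup]
  have he : (0 : UG × UH) ≤ (jG uG, jH uH) := ⟨hιG_unit.1, hιH_unit.1⟩
  have hunit : ∀ x : UG × UH, ∃ n : ℕ, x ≤ n • (jG uG, jH uH) := by
    rintro ⟨x, y⟩
    obtain ⟨n, hn⟩ := hιG_unit.2 x
    obtain ⟨m, hm⟩ := hιH_unit.2 y
    exact ⟨max n m, hn.trans (nsmul_le_nsmul_left hιG_unit.1 (le_max_left n m)),
      hm.trans (nsmul_le_nsmul_left hιH_unit.1 (le_max_right n m))⟩
  let T : Submodule ℝ (UG × UH) := D.uniformClosure _ he hunit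
  have hT_sup : ∀ p ∈ T, ∀ q ∈ T, p ⊔ q ∈ T := fun p hp q hq =>
    AddSubgroup.sup_mem_uniformClosure hD hp hq
  have hT_graph : ∀ g : G, (ιG g, ιH (h g)) ∈ T := fun g =>
    AddSubgroup.subset_uniformClosure ⟨g, rfl⟩
  have hT_near : ∀ x y, (x, y) ∈ T → ∀ k : ℕ, 0 < k → ∃ (n : ℕ) (g : G) (a : UG) (b : UH),
      0 < n ∧ n • a = jG g ∧ n • b = jH (φ g) ∧
      |x - a| ≤ (k : ℝ)⁻¹ • jG uG ∧ |y - b| ≤ (k : ℝ)⁻¹ • jH uH := by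
    intro x y hxy k hk
    obtain ⟨⟨a, b⟩, ⟨n, hn, g, hg⟩, hle⟩ := hxy (k : ℝ)⁻¹ (by positivity)
    exact ⟨n, g, a, b, hn, (congrArg Prod.fst hg).symm, (congrArg Prod.snd hg).symm,
      hle.1, hle.2⟩
  have hT_snd : ∀ y, ((0 : UG), y) ∈ T → y = 0 := by
    intro y hy
    refine eq_of_abs_sub_le_inv_smul hUHarch (jH uH) fun k hk => ?_
    obtain ⟨n, g, a, b, hn, ha, hb, hxa, hyb⟩ := hT_near _ _ hy k hk
    refine ⟨b, hyb, ?_⟩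
    rw [zero_sub, abs_neg, abs_le_inv_smul_iff jG hjG hn hk ha] at hxa
    rw [zero_sub, abs_neg, abs_le_inv_smul_iff jH hjH hn hk hb, ← hφu]
    simpa only [map_nsmul, map_neg] using And.intro (hφ hxa.1) (hφ hxa.2)
  have hT_fst : Function.Injective h → ∀ x, (x, (0 : UH)) ∈ T → x = 0 := by
    intro hinj x hx
    have hφ' : ∀ a b : G, φ a ≤ φ b ↔ a ≤ b := map_le_map_iff_of_map_sup hinj hh_sup
    refine eq_of_abs_sub_le_inv_smul hUGarch (jG uG) fun k hk => ?_
    obtain ⟨n, g, a, b, hn, ha, hb, hxa, hyb⟩ := hT_near _ _ hx k hk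
    refine ⟨a, hxa, ?_⟩
    rw [zero_sub, abs_neg, abs_le_inv_smul_iff jH hjH hn hk hb, ← hφu] at hyb
    rw [zero_sub, abs_neg, abs_le_inv_smul_iff jG hjG hn hk ha, ← hφ', ← hφ']
    simpa only [map_nsmul, map_neg] using hyb
  have hT_unique : ∀ {x y z}, (x, y) ∈ T → (x, z) ∈ T → y = z := fun hy hz =>
    sub_eq_zero.1 (hT_snd _ (by simpa using T.sub_mem hy hz))
  have hT_total : ∀ x, ∃ y, (x, y) ∈ T := by
    have hmem := hιG_gen (T.map (LinearMap.fst ℝ UG UH)) ?_ ?_ ?_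
    · intro x
      obtain ⟨⟨x, y⟩, hxy, rfl⟩ := hmem x
      exact ⟨y, hxy⟩
    · rintro _ ⟨p, hp, rfl⟩ _ ⟨q, hq, rfl⟩
      exact ⟨p ⊔ q, hT_sup p hp q hq, rfl⟩
    · rintro _ ⟨p, hp, rfl⟩ _ ⟨q, hq, rfl⟩
      refine ⟨-(-p ⊔ -q), T.neg_mem (hT_sup _ (T.neg_mem hp) _ (T.neg_mem hq)), ?_⟩
      rw [neg_sup, neg_neg, neg_neg]
      rfl
    · exact fun g => ⟨_, hT_graph g, rfl⟩
  choose R hR using hT_total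
  refine ⟨R, fun a b => hT_unique (hR _) (T.add_mem (hR a) (hR b)),
    fun a b => hT_unique (hR _) (hT_sup _ (hR a) _ (hR b)),
    fun g => hT_unique (hR _) (hT_graph g),
    fun r x => hT_unique (hR _) (T.smul_mem r (hR x)), fun hinj x y hxy => ?_,
    fun R' hadd hsup hι => funext fun x => ?_⟩
  · refine sub_eq_zero.1 (hT_fst hinj _ ?_)
    simpa [hxy] using T.sub_mem (hR x) (hR y)
  · let ρ : UG →+ UH := AddMonoidHom.mk' R' hadd
    have hρ : Monotone ρ := monotone_of_map_sup hsup
    have hρι : ∀ g, ρ (jG g) = jH (φ g) := hι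
    refine eq_of_abs_sub_le_inv_smul hUHarch (jH uH) fun k hk => ?_
    obtain ⟨n, g, a, b, hn, ha, hb, hxa, hyb⟩ := hT_near _ _ (hR x) k hk
    refine ⟨b, ?_, hyb⟩
    have hab : ρ a = b := by
      have hn' : (n : ℝ) ≠ 0 := by positivity
      refine smul_right_injective UH hn' ?_
      simp only [Nat.cast_smul_eq_nsmul]
      rw [← map_nsmul, ha, hρι, hb]
    have hρu : ρ ((k : ℝ)⁻¹ • jG uG) = (k : ℝ)⁻¹ • jH uH := by
      rw [map_inv_natCast_smul ρ ℝ ℝ, hρι, hφu]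
    have hle := abs_le'.1 hxa
    change |ρ x - b| ≤ _
    rw [← hab, ← map_sub, abs_le', ← map_neg, ← hρu]
    exact ⟨hρ hle.1, hρ hle.2⟩
end
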